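/- Let k be an algebraically closed field and G a finite group whose order is invertible in k, acting on kQ̄ = T(R,M̄) permuting the primitive idempotents, stabilizing the span of the arrows and fixing the preprojective relation r. Then there is an isomorphism of k-algebras (T(R,M̄)/(r))G ≅ T(RG, M̄G)/(r_G), where r_G is the preprojective relation of M̄G with respect to the extended bilinear form; that is, the skew group algebra of the preprojective algebra is the quotient of the tensor algebra T(RG, M̄G) by its own preprojective relation. -/

import Mathlib

open scoped TensorProduct
open CategoryTheory

noncomputable section

universe u

/-- A right action of a group `G` on a `k`-algebra `L` by `k`-algebra automorphisms,
written `a ^ g = act.ρ g a`. -/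
structure RightGAction (k : Type u) [CommRing k] (L : Type u) [Ring L] [Algebra k L]
    (G : Type u) [Group G] : Type u where
  ρ : G → L ≃ₐ[k] L
  ρ_one : ∀ a, ρ 1 a = a
  ρ_mul : ∀ g h a, ρ (g * h) a = ρ h (ρ g a)

/-- `A` is a skew group algebra `L G` for the right action `act` of `G` on `L`:
it contains `L` as a subalgebra, `G` as a subgroup of units satisfying
`g⁻¹ * a * g = a ^ g`, and is freely spanned by the products `a * g`;
this encodes the algebra `L ⊗ₖ k[G]` with `(a ⊗ g) * (a' ⊗ g') = a * (a' ^ g⁻¹) ⊗ g g'`. -/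
structure IsSkewGroupAlgebra {k L G : Type u} [CommRing k] [Ring L] [Algebra k L] [Group G]
    (act : RightGAction k L G) (A : Type u) [Ring A] [Algebra k A] : Type u where
  ι : L →ₐ[k] A
  γ : G →* Aˣ
  conj_eq : ∀ (g : G) (a : L), (↑(γ g)⁻¹ : A) * ι a * ↑(γ g) = ι (act.ρ g a)
  repr_exists : ∀ x : A, ∃ c : G →₀ L, x = c.sum fun g a => ι a * ↑(γ g)
  repr_unique : ∀ c d : G →₀ L,
    (c.sum fun g a => ι a * ↑(γ g)) = (d.sum fun g a => ι a * ↑(γ g)) → c = d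

/-- Paths in the quiver with arrow set `Arr`, source and target maps `src`, `tgt`. -/
inductive QPath {I Arr : Type u} (src tgt : Arr → I) : I → I → Type u
  | nil (i : I) : QPath src tgt i i
  | cons {i j l : I} (p : QPath src tgt i j) (a : Arr) (hs : src a = j) (ht : tgt a = l) :
      QPath src tgt i l

/-- The product, in an algebra `P`, of the arrows of a path (target-to-source order),
where `e` interprets the vertices and `arr` the arrows. -/
def pathProd {I Arr P : Type u} [Semiring P] {src tgt : Arr → I} (e : I → P) (arr : Arr → P)
    {i j : I} (p : QPath src tgt i j) : P :=
  match i, j, p with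
  | _, _, .nil i0 => e i0
  | _, _, .cons q a _ _ => arr a * pathProd e arr q

/-- `P` is the path algebra `kQ` of the quiver `Q = (I, Arr, src, tgt)`:
the vertices give a complete family of orthogonal idempotents `e i`, arrows give
elements `arr a` with `e (tgt a) * arr a * e (src a) = arr a`, and
the products of arrows along paths form a `k`-basis of `P`. -/
structure IsPathAlgebra (k : Type u) [CommRing k] {I Arr : Type u} [Fintype I]
    [DecidableEq I] (src tgt : Arr → I) (P : Type u) [Ring P] [Algebra k P] : Type u where
  e : I → P
  arr : Arr → P
  orth : ∀ i j, e i * e j = if i = j then e i else 0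
  sum_one : (∑ i, e i) = 1
  sandwich : ∀ a, e (tgt a) * arr a * e (src a) = arr a
  indep : LinearIndependent k
    (fun x : Σ i : I, Σ j : I, QPath src tgt i j => pathProd e arr x.2.2)
  span_top : Submodule.span k
    (Set.range fun x : Σ i : I, Σ j : I, QPath src tgt i j => pathProd e arr x.2.2) = ⊤

/-- An action of `G` on the path algebra `P` of a quiver permuting the primitive
idempotents (via the right action `π` on vertices) and stabilizing the span of the arrows. -/
structure ActionOnPathAlgebra (k : Type u) [CommRing k] {I Arr : Type u} [Fintype I]
    [DecidableEq I] (src tgt : Arr → I) (P : Type u) [Ring P] [Algebra k P]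
    (G : Type u) [Group G] : Type u where
  pa : IsPathAlgebra k src tgt P
  act : RightGAction k P G
  π : G → I → I
  π_one : ∀ i, π 1 i = i
  π_mul : ∀ g h i, π (g * h) i = π h (π g i)
  e_perm : ∀ g i, act.ρ g (pa.e i) = pa.e (π g i)
  arrows_stable : ∀ (g : G), ∀ x ∈ Submodule.span k (Set.range pa.arr),
    act.ρ g x ∈ Submodule.span k (Set.range pa.arr)

namespace ActionOnPathAlgebra

variable {k : Type u} [CommRing k] {I Arr : Type u} [Fintype I] [DecidableEq I]
  {src tgt : Arr → I} {P : Type u} [Ring P] [Algebra k P] {G : Type u} [Group G]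

/-- The stabilizer `G_i` of the primitive idempotent `e i`. -/
def Stab (S : ActionOnPathAlgebra k src tgt P G) (i : I) : Subgroup G where
  carrier := {g | S.π g i = i}
  one_mem' := S.π_one i
  mul_mem' := by
    intro a b ha hb
    simp only [Set.mem_setOf_eq] at *
    rw [S.π_mul, ha, hb]
  inv_mem' := by
    intro a ha
    simp only [Set.mem_setOf_eq] at *
    calc S.π a⁻¹ i = S.π a⁻¹ (S.π a i) := by rw [ha]
    _ = S.π (a * a⁻¹) i := (S.π_mul a a⁻¹ i).symm
    _ = i := by rw [mul_inv_cancel, S.π_one]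

@[simp] theorem mem_Stab (S : ActionOnPathAlgebra k src tgt P G) (i : I) (g : G) :
    g ∈ S.Stab i ↔ S.π g i = i := Iff.rfl

/-- The span `M_{i'j'}` of the arrows from `i'` to `j'`. -/
def Mij (S : ActionOnPathAlgebra k src tgt P G) (i' j' : I) : Submodule k P :=
  Submodule.span k {x | ∃ a : Arr, src a = i' ∧ tgt a = j' ∧ x = S.pa.arr a}

end ActionOnPathAlgebra

/-- Data of orbit representatives for a right action `π` of `G` on `I`:
`rep i` is the chosen representative `i∘` of the orbit of `i` and `κ i` is a group
element with `i∘ ^ (κ i) = i`. -/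
structure OrbitData {G I : Type u} [Group G] (π : G → I → I) : Type u where
  rep : I → I
  κ : I → G
  rep_rep : ∀ i, rep (rep i) = rep i
  rep_const : ∀ g i, rep (π g i) = rep i
  κ_spec : ∀ i, π (κ i) (rep i) = i

section conj

variable {k : Type u} [CommRing k] {I Arr : Type u} [Fintype I] [DecidableEq I]
  {src tgt : Arr → I} {P : Type u} [Ring P] [Algebra k P] {G : Type u} [Group G]

theorem conj_mem (S : ActionOnPathAlgebra k src tgt P G) (O : OrbitData S.π) {i' c : I}
    (hc : O.rep i' = c) {g : G} (hg : g ∈ S.Stab i') :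
    O.κ i' * g * (O.κ i')⁻¹ ∈ S.Stab c := by
  have h1 : S.π (O.κ i') c = i' := by rw [← hc]; exact O.κ_spec i'
  have hg' : S.π g i' = i' := hg
  have h2 : S.π (O.κ i' * g * (O.κ i')⁻¹) c = S.π (O.κ i')⁻¹ i' := by
    rw [S.π_mul, S.π_mul, h1, hg']
  have h3 : S.π (O.κ i')⁻¹ i' = c := by
    have h4 := S.π_mul (O.κ i') (O.κ i')⁻¹ c
    rw [mul_inv_cancel, S.π_one, h1] at h4
    exact h4.symm
  show S.π _ c = c
  rw [h2, h3]

/-- Conjugation by `κ i'`, as a group homomorphism from a subgroup `H ≤ G_{i'}`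
to the stabilizer `G_c` of the chosen representative `c` of the orbit of `i'`;
this implements the correspondence `G_{i'} = κ_{i'}⁻¹ G_{i∘} κ_{i'}`. -/
def conjHom (S : ActionOnPathAlgebra k src tgt P G) (O : OrbitData S.π) {i' c : I}
    (hc : O.rep i' = c) (H : Subgroup G) (hH : H ≤ S.Stab i') :
    H →* (S.Stab c) where
  toFun g := ⟨O.κ i' * ↑g * (O.κ i')⁻¹, conj_mem S O hc (hH g.2)⟩
  map_one' := by ext; simp
  map_mul' g h := by ext; simp only [Subgroup.coe_mul]; group

end conj
section Double

variable {k : Type u} [CommRing k] {I Arr : Type u}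

/-- Source map of the double quiver `Q̄` of `Q = (I, Arr, src, tgt)`: its arrows are
`Sum.inl a = a` and `Sum.inr a = a*` (the reversal of `a`). -/
def dsrc (src tgt : Arr → I) : Arr ⊕ Arr → I := Sum.elim src tgt

/-- Target map of the double quiver `Q̄`. -/
def dtgt (src tgt : Arr → I) : Arr ⊕ Arr → I := Sum.elim tgt src

variable [Fintype I] [DecidableEq I] {src tgt : Arr → I}
  {PB : Type u} [Ring PB] [Algebra k PB]

/-- The preprojective relation `r = Σ_s x_s · x_s^* ∈ M̄ ⊗_R M̄`, viewed inside the path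
algebra of the double quiver (in which the degree two part `M̄ ⊗_R M̄` embeds): for the
basis of `M̄` given by the arrows, the left dual basis for the canonical symplectic form
is given by `(a)^* = -a*` and `(a*)^* = a`, so that `r = Σ_a (a* · a - a · a*)`. -/
def preprojRel [Fintype Arr] (pa : IsPathAlgebra k (dsrc src tgt) (dtgt src tgt) PB) : PB :=
  ∑ a : Arr,
    (pa.arr (Sum.inr a) * pa.arr (Sum.inl a) - pa.arr (Sum.inl a) * pa.arr (Sum.inr a))

/-- `B` restricts, on the span `M̄` of the arrows of the double quiver, to the canonical
non-degenerate skew-symmetric bilinear form `⟨m + f, m' + f'⟩ = f'(m) - f(m')` (for which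
the arrows of `Q` span `M` and the reversed arrows span the dual `M^*`). -/
def IsCanonicalForm [DecidableEq Arr] (pa : IsPathAlgebra k (dsrc src tgt) (dtgt src tgt) PB)
    (B : PB →ₗ[k] PB →ₗ[k] k) : Prop :=
  (∀ a b : Arr, B (pa.arr (Sum.inl a)) (pa.arr (Sum.inl b)) = 0) ∧
  (∀ a b : Arr, B (pa.arr (Sum.inr a)) (pa.arr (Sum.inr b)) = 0) ∧
  (∀ a b : Arr, B (pa.arr (Sum.inl a)) (pa.arr (Sum.inr b)) = if a = b then 1 else 0) ∧
  (∀ a b : Arr, B (pa.arr (Sum.inr a)) (pa.arr (Sum.inl b)) = if a = b then -1 else 0)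

end Double

namespace IsSkewGroupAlgebra

variable {k L G : Type u} [CommRing k] [Ring L] [Algebra k L] [Group G]
  {act : RightGAction k L G} {A : Type u} [Ring A] [Algebra k A]

theorem γ_mul_ι (sk : IsSkewGroupAlgebra act A) (g : G) (a : L) :
    (sk.γ g : A) * sk.ι (act.ρ g a) = sk.ι a * sk.γ g := by
  rw [← sk.conj_eq, mul_assoc, Units.mul_inv_cancel_left]

theorem ρ_ρ_inv (act : RightGAction k L G) (g : G) (a : L) :
    act.ρ g (act.ρ g⁻¹ a) = a := by
  rw [← act.ρ_mul, inv_mul_cancel, act.ρ_one]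

theorem mul_monomial (sk : IsSkewGroupAlgebra act A) (a b : L) (g h : G) :
    (sk.ι a * sk.γ g) * (sk.ι b * sk.γ h) = sk.ι (a * act.ρ g⁻¹ b) * sk.γ (g * h) := by
  have := sk.γ_mul_ι g (act.ρ g⁻¹ b)
  rw [ρ_ρ_inv] at this
  rw [mul_assoc, ← mul_assoc (sk.γ g : A), this, map_mul, map_mul, Units.val_mul]
  simp only [mul_assoc]

theorem induction_on (sk : IsSkewGroupAlgebra act A) {p : A → Prop} (x : A)
    (zero : p 0) (add : ∀ x y, p x → p y → p (x + y))
    (monomial : ∀ a g, p (sk.ι a * sk.γ g)) : p x := by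
  obtain ⟨c, rfl⟩ := sk.repr_exists x
  exact Finset.sum_induction _ p add zero fun g _ => monomial _ g

/-- The decomposition of a skew group algebra as a free module over the acting group. -/
def linearEquiv (sk : IsSkewGroupAlgebra act A) : (G →₀ L) ≃ₗ[k] A :=
  LinearEquiv.ofBijective
    (Finsupp.lsum k fun g => LinearMap.mulRight k (sk.γ g : A) ∘ₗ sk.ι.toLinearMap)
    ⟨fun c d h => sk.repr_unique c d h, fun x => (sk.repr_exists x).imp fun _ h => h.symm⟩

theorem linearEquiv_single (sk : IsSkewGroupAlgebra act A) (g : G) (a : L) :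
    sk.linearEquiv (Finsupp.single g a) = sk.ι a * sk.γ g := by
  exact (Finsupp.lsum_single k _ g a).trans rfl

variable {B : Type u} [Ring B] [Algebra k B]

/-- The linear map out of a skew group algebra with prescribed restrictions. -/
def liftLinear (sk : IsSkewGroupAlgebra act A) (f : L →ₐ[k] B) (u : G →* Bˣ) : A →ₗ[k] B :=
  (Finsupp.lsum k fun g => LinearMap.mulRight k (u g : B) ∘ₗ f.toLinearMap) ∘ₗ
    sk.linearEquiv.symm.toLinearMap

theorem liftLinear_monomial (sk : IsSkewGroupAlgebra act A) (f : L →ₐ[k] B) (u : G →* Bˣ)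
    (a : L) (g : G) : sk.liftLinear f u (sk.ι a * sk.γ g) = f a * u g := by
  simp [liftLinear, ← linearEquiv_single]

/-- The universal property of a skew group algebra: an algebra homomorphism and a compatible
group homomorphism extend to it. -/
def lift (sk : IsSkewGroupAlgebra act A) (f : L →ₐ[k] B) (u : G →* Bˣ)
    (h : ∀ g a, (u g : B) * f (act.ρ g a) = f a * u g) : A →ₐ[k] B :=
  AlgHom.ofLinearMap (sk.liftLinear f u)
    (by simpa using sk.liftLinear_monomial f u 1 1)
    (fun x y => by
      induction x using sk.induction_on with
      | zero => simp
      | add x x' hx hx' => rw [add_mul, map_add, map_add, add_mul, hx, hx']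
      | monomial a g =>
      induction y using sk.induction_on with
      | zero => simp
      | add y y' hy hy' => rw [mul_add, map_add, map_add, mul_add, hy, hy']
      | monomial b g' =>
      have := h g (act.ρ g⁻¹ b)
      rw [ρ_ρ_inv] at this
      rw [mul_monomial, liftLinear_monomial, liftLinear_monomial, liftLinear_monomial,
        map_mul f, map_mul u, Units.val_mul, mul_assoc, ← mul_assoc (f _) (u g : B), ← this]
      simp only [mul_assoc])

variable (sk : IsSkewGroupAlgebra act A) (f : L →ₐ[k] B) (u : G →* Bˣ)
  (h : ∀ g a, (u g : B) * f (act.ρ g a) = f a * u g)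

theorem lift_ι (a : L) : sk.lift f u h (sk.ι a) = f a := by
  simpa using! sk.liftLinear_monomial f u a 1

theorem lift_γ (g : G) : sk.lift f u h (sk.γ g) = u g := by
  simpa using! sk.liftLinear_monomial f u 1 g

theorem algHom_ext (sk : IsSkewGroupAlgebra act A) {φ ψ : A →ₐ[k] B}
    (hι : ∀ a, φ (sk.ι a) = ψ (sk.ι a)) (hγ : ∀ g, φ (sk.γ g) = ψ (sk.γ g)) : φ = ψ := by
  ext x
  induction x using sk.induction_on with
  | zero => simp
  | add x y hx hy => rw [map_add, map_add, hx, hy]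
  | monomial a g => rw [map_mul, map_mul, hι, hγ]

/-- The skew group algebra of a quotient by one relation `r` is the quotient of the skew group
algebra by any element associated to `r` through an invertible scalar. -/
theorem exists_algEquiv_ringQuot (sk : IsSkewGroupAlgebra act A) (r : L) (s : A)
    (n : k) (hn : IsUnit n) (hs : s = n • sk.ι r)
    (actQ : RightGAction k (RingQuot (fun x y : L => x = r ∧ y = 0)) G)
    (hactQ : ∀ (g : G) (x : L),
      actQ.ρ g (RingQuot.mkAlgHom k (fun x y : L => x = r ∧ y = 0) x) =
        RingQuot.mkAlgHom k (fun x y : L => x = r ∧ y = 0) (act.ρ g x))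
    {C : Type u} [Ring C] [Algebra k C] (skC : IsSkewGroupAlgebra actQ C) :
    ∃ Φ : C ≃ₐ[k] RingQuot (fun x y : A => x = s ∧ y = 0),
      (∀ x : L,
        Φ (skC.ι (RingQuot.mkAlgHom k (fun x y : L => x = r ∧ y = 0) x)) =
          RingQuot.mkAlgHom k (fun x y : A => x = s ∧ y = 0) (sk.ι x)) ∧
      (∀ g : G,
        Φ (skC.γ g) = RingQuot.mkAlgHom k (fun x y : A => x = s ∧ y = 0) (sk.γ g)) := by
  set q := RingQuot.mkAlgHom k (fun x y : L => x = r ∧ y = 0)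
  set Q := RingQuot.mkAlgHom k (fun x y : A => x = s ∧ y = 0)
  have hqs : Function.Surjective q := RingQuot.mkAlgHom_surjective k _
  have hqr : q r = 0 := by
    simpa using RingQuot.mkAlgHom_rel k (s := fun x y : L => x = r ∧ y = 0) ⟨rfl, rfl⟩
  have hQs : Q s = 0 := by
    simpa using RingQuot.mkAlgHom_rel k (s := fun x y : A => x = s ∧ y = 0) ⟨rfl, rfl⟩
  have hQr : Q (sk.ι r) = 0 := by
    have hns : n • Q (sk.ι r) = 0 := by rw [← map_smul, ← hs, hQs]
    exact hn.smul_eq_zero.mp hns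
  let f : RingQuot (fun x y : L => x = r ∧ y = 0) →ₐ[k]
      RingQuot (fun x y : A => x = s ∧ y = 0) :=
    RingQuot.liftAlgHom k ⟨Q.comp sk.ι, by rintro x y ⟨rfl, rfl⟩; simpa using hQr⟩
  have hf : ∀ x, f (q x) = Q (sk.ι x) := fun x => RingQuot.liftAlgHom_mkAlgHom_apply k _ _ x
  let u := (Units.map (Q : A →* RingQuot (fun x y : A => x = s ∧ y = 0))).comp sk.γ
  have hfcomm : ∀ g a, (u g : RingQuot (fun x y : A => x = s ∧ y = 0)) * f (actQ.ρ g a) =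
      f a * u g := by
    intro g a
    obtain ⟨a, rfl⟩ := hqs a
    rw [hactQ, hf, hf]
    simpa [u] using congrArg Q (sk.γ_mul_ι g a)
  let F := skC.lift f u hfcomm
  have hFι : ∀ x, F (skC.ι (q x)) = Q (sk.ι x) := fun x => by
    rw [← hf]; exact skC.lift_ι _ _ hfcomm _
  have hFγ : ∀ g, F (skC.γ g) = Q (sk.γ g) := fun g => skC.lift_γ _ _ hfcomm g
  have hcomm : ∀ g a, (skC.γ g : C) * (skC.ι.comp q) (act.ρ g a) =
      (skC.ι.comp q) a * skC.γ g := by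
    intro g a
    simpa [hactQ] using skC.γ_mul_ι g (q a)
  let E := sk.lift (skC.ι.comp q) skC.γ hcomm
  have hEι : ∀ x, E (sk.ι x) = skC.ι (q x) := sk.lift_ι _ _ hcomm
  have hEγ : ∀ g, E (sk.γ g) = skC.γ g := sk.lift_γ _ _ hcomm
  let E' : RingQuot (fun x y : A => x = s ∧ y = 0) →ₐ[k] C :=
    RingQuot.liftAlgHom k ⟨E, by
      rintro x y ⟨rfl, rfl⟩
      rw [hs, map_smul, hEι, hqr, map_zero, smul_zero, map_zero]⟩
  have hE' : ∀ x, E' (Q x) = E x := fun x => RingQuot.liftAlgHom_mkAlgHom_apply k _ _ x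
  have hFE : F.comp E' = AlgHom.id k _ := by
    apply RingQuot.ringQuot_ext'
    refine sk.algHom_ext ?_ ?_
    · intro a
      change F (E' (Q _)) = Q _
      rw [hE', hEι, hFι]
    · intro g
      change F (E' (Q _)) = Q _
      rw [hE', hEγ, hFγ]
  have hEF : E'.comp F = AlgHom.id k _ := by
    refine skC.algHom_ext ?_ ?_
    · intro a
      obtain ⟨a, rfl⟩ := hqs a
      change E' (F _) = _
      rw [hFι, hE', hEι, AlgHom.id_apply]
    · intro g
      change E' (F _) = _
      rw [hFγ, hE', hEγ, AlgHom.id_apply]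
  exact ⟨AlgEquiv.ofAlgHom F E' hFE hEF, hFι, hFγ⟩

end IsSkewGroupAlgebra

/-- **Theorem: the skew group algebra of the preprojective algebra.** If `G` acts on
`kQ̄ = T(R, M̄)` permuting the primitive idempotents, stabilizing the span of the arrows
and fixing the preprojective relation `r`, then there is a canonical isomorphism of
`k`-algebras `(T(R,M̄)/(r))G ≅ T(RG, M̄G)/(r_G)`, where `r_G` is the preprojective
relation of `M̄G` for the extended bilinear form (computed here in `A ≅ T(RG, M̄G)`,
the skew group algebra of `kQ̄`, from the basis `{x_s ⊗ g}` of `M̄G` and its left dual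
basis `{x_s^{*g} ⊗ g⁻¹}`): the isomorphism is compatible with the canonical maps from
the preprojective algebra and from `G`. -/
theorem skew_group_algebra_of_preprojective_algebra
    (k : Type u) [Field k] [IsAlgClosed k] (G : Type u) [Group G] [Fintype G]
    (hord : (Fintype.card G : k) ≠ 0)
    (I Arr : Type u) [Fintype I] [DecidableEq I] [Fintype Arr]
    (src tgt : Arr → I) (PB : Type u) [Ring PB] [Algebra k PB]
    (S : ActionOnPathAlgebra k (dsrc src tgt) (dtgt src tgt) PB G)
    (hfix : ∀ g : G, S.act.ρ g (preprojRel S.pa) = preprojRel S.pa)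
    (A : Type u) [Ring A] [Algebra k A] (sk : IsSkewGroupAlgebra S.act A)
    -- the skew group algebra `C = Λ_Q G` of the preprojective algebra
    -- `Λ_Q = kQ̄/(r)`, for the action induced on the quotient
    (actQ : RightGAction k (RingQuot (fun x y : PB => x = preprojRel S.pa ∧ y = 0)) G)
    (hactQ : ∀ (g : G) (x : PB),
      actQ.ρ g (RingQuot.mkAlgHom k (fun x y : PB => x = preprojRel S.pa ∧ y = 0) x) =
        RingQuot.mkAlgHom k (fun x y : PB => x = preprojRel S.pa ∧ y = 0) (S.act.ρ g x))
    (C : Type u) [Ring C] [Algebra k C] (skC : IsSkewGroupAlgebra actQ C) :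
    -- `r_G ∈ A`, the preprojective relation of `M̄G` for the extended form
    ∀ rGA : A,
      rGA = ∑ g : G, ∑ a : Arr,
        ((sk.ι (S.pa.arr (Sum.inl a)) * ↑(sk.γ g)) *
            (sk.ι (S.act.ρ g (-(S.pa.arr (Sum.inr a)))) * ↑(sk.γ g⁻¹)) +
         (sk.ι (S.pa.arr (Sum.inr a)) * ↑(sk.γ g)) *
            (sk.ι (S.act.ρ g (S.pa.arr (Sum.inl a))) * ↑(sk.γ g⁻¹))) →
      ∃ Φ : C ≃ₐ[k] RingQuot (fun x y : A => x = rGA ∧ y = 0),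
        (∀ x : PB,
          Φ (skC.ι (RingQuot.mkAlgHom k (fun x y : PB => x = preprojRel S.pa ∧ y = 0) x)) =
            RingQuot.mkAlgHom k (fun x y : A => x = rGA ∧ y = 0) (sk.ι x)) ∧
        (∀ g : G,
          Φ ↑(skC.γ g) = RingQuot.mkAlgHom k (fun x y : A => x = rGA ∧ y = 0) ↑(sk.γ g)) := by
  rintro rGA rfl
  refine sk.exists_algEquiv_ringQuot _ _ (Fintype.card G : k) hord.isUnit ?_ actQ hactQ skC
  have term : ∀ (g : G) (x y : PB),
      (sk.ι x * sk.γ g) * (sk.ι (S.act.ρ g y) * ↑(sk.γ g⁻¹)) = sk.ι (x * y) := by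
    intro g x y
    rw [sk.mul_monomial, ← S.act.ρ_mul, mul_inv_cancel, S.act.ρ_one, map_one, Units.val_one,
      mul_one]
  simp only [term, ← map_add, ← map_sum, Finset.sum_const, Finset.card_univ]
  rw [← Nat.cast_smul_eq_nsmul k, map_smul]
  congr 3
  ext a
  rw [mul_neg, neg_add_eq_sub]
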